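/- There exists a constant C > 0 (depending only on q and χ) such that for every real x ≥ 3 and every s ∈ ℂ with Re(s) ≥ 1, one has Re(∑_{1 < n ≤ x} Λ(n)·χ(n)/(n^s·log n)) ≤ log(log x) + C₀ − log(q/φ(q)) + C/log x. -/

import Mathlib

open Complex DirichletCharacter Finset Filter Topology

/-- Weak form of Mertens' first theorem. -/
lemma abs_sum_vonMangoldt_div_sub_log_le :
    ∃ K : ℝ, ∀ N : ℕ, 1 ≤ N →
      |∑ n ∈ Ioc 0 N, ArithmeticFunction.vonMangoldt n / n - Real.log N| ≤ K := by
  refine ⟨Real.log 4 + 4 + 1, fun N hN ↦ ?_⟩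
  have hN0 : (0 : ℝ) < N := by exact_mod_cast hN
  have hid : Real.log (N.factorial : ℝ) =
      ∑ n ∈ Ioc 0 N, ArithmeticFunction.vonMangoldt n * ((N / n : ℕ) : ℝ) := by
    have h := ArithmeticFunction.sum_Ioc_mul_zeta_eq_sum ArithmeticFunction.vonMangoldt N
    rw [ArithmeticFunction.vonMangoldt_mul_zeta] at h
    rw [← h, ← Finset.prod_Ico_id_eq_factorial, Nat.cast_prod, Real.log_prod]
    · rfl
    · intro i hi
      have := (Finset.mem_Ico.mp hi).1
      positivity
  have hpsi : Chebyshev.psi N = ∑ n ∈ Ioc 0 N, ArithmeticFunction.vonMangoldt n := by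
    simp [Chebyshev.psi]
  have hpsi_le : Chebyshev.psi N ≤ (Real.log 4 + 4) * N :=
    Chebyshev.psi_le_const_mul_self hN0.le
  have hup : Real.log (N.factorial : ℝ) ≤
      N * ∑ n ∈ Ioc 0 N, ArithmeticFunction.vonMangoldt n / n := by
    rw [hid, Finset.mul_sum]
    refine Finset.sum_le_sum fun n _ ↦ ?_
    have : ((N / n : ℕ) : ℝ) ≤ N / n := Nat.cast_div_le
    calc _ ≤ ArithmeticFunction.vonMangoldt n * ((N : ℝ) / n) := by
          gcongr
      _ = _ := by ring
  have hlow : N * ∑ n ∈ Ioc 0 N, ArithmeticFunction.vonMangoldt n / n - Chebyshev.psi N ≤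
      Real.log (N.factorial : ℝ) := by
    rw [hid, Finset.mul_sum, hpsi, ← Finset.sum_sub_distrib]
    refine Finset.sum_le_sum fun n _ ↦ ?_
    have : (N : ℝ) / n - 1 ≤ ((N / n : ℕ) : ℝ) := by
      have := Nat.sub_one_lt_floor ((N : ℝ) / n)
      rw [Nat.floor_div_natCast, Nat.floor_natCast] at this
      exact this.le
    calc _ = ArithmeticFunction.vonMangoldt n * ((N : ℝ) / n - 1) := by ring
      _ ≤ _ := by gcongr
  have hs1 : N * Real.log N - N ≤ Real.log (N.factorial : ℝ) := by
    have h := Stirling.le_log_factorial_stirling (n := N) (by omega)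
    have h1 : 0 ≤ Real.log N := Real.log_natCast_nonneg N
    have h2 : 0 ≤ Real.log (2 * Real.pi) := by
      apply Real.log_nonneg; nlinarith [Real.pi_gt_three]
    linarith
  have hs2 : Real.log (N.factorial : ℝ) ≤ N * Real.log N := by
    rw [← Real.log_pow]
    apply Real.log_le_log (by positivity)
    exact_mod_cast Nat.factorial_le_pow N
  have hlog4 : 0 ≤ Real.log 4 := Real.log_nonneg (by norm_num)
  rw [abs_le]
  constructor
  · refine le_of_mul_le_mul_left ?_ hN0
    nlinarith
  · refine le_of_mul_le_mul_left ?_ hN0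
    nlinarith

/-- The von Mangoldt function restricted to integers coprime to `q`. -/
noncomputable def coprimeVonMangoldt (q n : ℕ) : ℝ :=
  if n.Coprime q then ArithmeticFunction.vonMangoldt n else 0

lemma coprimeVonMangoldt_nonneg (q n : ℕ) : 0 ≤ coprimeVonMangoldt q n := by
  unfold coprimeVonMangoldt
  split_ifs
  exacts [ArithmeticFunction.vonMangoldt_nonneg, le_rfl]

lemma coprimeVonMangoldt_le (q n : ℕ) :
    coprimeVonMangoldt q n ≤ ArithmeticFunction.vonMangoldt n := by
  unfold coprimeVonMangoldt
  split_ifs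
  exacts [le_rfl, ArithmeticFunction.vonMangoldt_nonneg]

lemma coprimeVonMangoldt_le_log (q n : ℕ) : coprimeVonMangoldt q n ≤ Real.log n :=
  (coprimeVonMangoldt_le q n).trans ArithmeticFunction.vonMangoldt_le_log

lemma summable_vonMangoldt_sub_coprimeVonMangoldt_div {q : ℕ} (hq : q ≠ 0) :
    Summable fun n : ℕ ↦ (ArithmeticFunction.vonMangoldt n - coprimeVonMangoldt q n) / n := by
  have h1 : Summable fun n : ℕ ↦
      (if n.Prime then 0 else ArithmeticFunction.vonMangoldt n) / (n : ℝ) := by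
    have h := ArithmeticFunction.vonMangoldt.summable_residueClass_non_primes_div (q := 1) 0
    refine h.congr fun n ↦ ?_
    have : ArithmeticFunction.vonMangoldt.residueClass (0 : ZMod 1) n =
        ArithmeticFunction.vonMangoldt n :=
      Set.indicator_of_mem (s := {n : ℕ | (n : ZMod 1) = 0})
        (Set.mem_ofPred.mpr (Subsingleton.elim (α := ZMod 1) _ _)) _
    rw [this]
  have h2 : Summable fun n : ℕ ↦
      if n ∈ q.primeFactors then ArithmeticFunction.vonMangoldt n / (n : ℝ) else 0 :=
    summable_of_ne_finset_zero (s := q.primeFactors) fun n hn ↦ if_neg hn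
  refine (h1.add h2).of_nonneg_of_le (fun n ↦ ?_) fun n ↦ ?_
  · exact div_nonneg (sub_nonneg.mpr (coprimeVonMangoldt_le q n)) n.cast_nonneg
  · have h0 : 0 ≤ ArithmeticFunction.vonMangoldt n / (n : ℝ) :=
      div_nonneg ArithmeticFunction.vonMangoldt_nonneg n.cast_nonneg
    unfold coprimeVonMangoldt
    by_cases hc : n.Coprime q
    · rw [if_pos hc, sub_self, zero_div]
      split_ifs <;> simp [h0]
    · rw [if_neg hc, sub_zero]
      by_cases hp : n.Prime
      · have : n ∈ q.primeFactors := by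
          rw [Nat.mem_primeFactors]
          exact ⟨hp, by_contra fun h ↦ hc ((hp.coprime_iff_not_dvd).mpr h), hq⟩
        rw [if_pos hp, if_pos this]; simp
      · rw [if_neg hp]
        split_ifs <;> simp [h0]

lemma abs_sum_coprimeVonMangoldt_div_sub_log_le {q : ℕ} (hq : q ≠ 0) :
    ∃ K : ℝ, ∀ N : ℕ, 1 ≤ N →
      |∑ n ∈ Ioc 0 N, coprimeVonMangoldt q n / n - Real.log N| ≤ K := by
  obtain ⟨K, hK⟩ := abs_sum_vonMangoldt_div_sub_log_le
  have hs := summable_vonMangoldt_sub_coprimeVonMangoldt_div hq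
  refine ⟨K + ∑' n : ℕ, (ArithmeticFunction.vonMangoldt n - coprimeVonMangoldt q n) / n,
    fun N hN ↦ ?_⟩
  have hnn (n : ℕ) : 0 ≤ (ArithmeticFunction.vonMangoldt n - coprimeVonMangoldt q n) / n :=
    div_nonneg (sub_nonneg.mpr (coprimeVonMangoldt_le q n)) n.cast_nonneg
  have h1 := hs.sum_le_tsum (Ioc 0 N) fun n _ ↦ hnn n
  have h2 := Finset.sum_nonneg (s := Ioc 0 N) fun n _ ↦ hnn n
  simp only [sub_div, Finset.sum_sub_distrib] at h1 h2 ⊢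
  have := abs_le.mp (hK N hN)
  rw [abs_le]
  constructor <;> linarith [this.1, this.2]

lemma log_sub_log_le_div {a b : ℝ} (ha : 0 < a) (hb : 0 < b) :
    Real.log b - Real.log a ≤ (b - a) / a := by
  have := Real.log_le_sub_one_of_pos (div_pos hb ha)
  rw [Real.log_div hb.ne' ha.ne'] at this
  rwa [sub_div, div_self ha.ne']

/-- Partial summation against `1 / log`, for a weight whose summatory function is
`log N + O(1)`. -/
lemma abs_sum_div_log_sub_log_log_le {b : ℕ → ℝ} {K : ℝ}
    (hb : ∀ N : ℕ, 1 ≤ N → |∑ n ∈ Ioc 0 N, b n - Real.log N| ≤ K)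
    {N M : ℕ} (hN : 2 ≤ N) (hNM : N ≤ M) :
    |∑ n ∈ Ioc N M, b n / Real.log n -
      (Real.log (Real.log M) - Real.log (Real.log N))| ≤ (2 * K + 1) / Real.log N := by
  set R : ℕ → ℝ := fun n ↦ ∑ k ∈ Ioc 0 n, b k - Real.log n with hR
  have hlogpos {n : ℕ} (hn : 2 ≤ n) : 0 < Real.log n := Real.log_pos (by exact_mod_cast hn)
  have key : |∑ n ∈ Ioc N M, b n / Real.log n -
      (Real.log (Real.log M) - Real.log (Real.log N)) - R M / Real.log M + R N / Real.log N| ≤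
      (K + 1) * (1 / Real.log N - 1 / Real.log M) := by
    induction M, hNM using Nat.le_induction with
    | base => simp
    | succ M hNM ih =>
      have hM : 2 ≤ M := hN.trans hNM
      have l0 := hlogpos hM
      have l1 : 0 < Real.log ((M + 1 : ℕ) : ℝ) := hlogpos (by omega)
      have hle : Real.log M ≤ Real.log ((M + 1 : ℕ) : ℝ) :=
        Real.log_le_log (by positivity) (by push_cast; linarith)
      have hδ : Real.log ((M + 1 : ℕ) : ℝ) - Real.log M ≤ 1 := by
        refine (log_sub_log_le_div (by positivity) (by positivity)).trans ?_
        rw [div_le_one (by positivity)]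
        have : (2 : ℝ) ≤ M := by exact_mod_cast hM
        push_cast; linarith
      have hw : 0 ≤ 1 / Real.log M - 1 / Real.log ((M + 1 : ℕ) : ℝ) :=
        sub_nonneg.mpr (one_div_le_one_div_of_le l0 hle)
      have hup := log_sub_log_le_div l0 l1
      have hlow := log_sub_log_le_div l1 l0
      have hRM := hb M (by omega)
      have hbR : b (M + 1) = R (M + 1) - R M +
          (Real.log ((M + 1 : ℕ) : ℝ) - Real.log M) := by
        simp only [hR]
        rw [Finset.sum_Ioc_succ_top (by omega)]
        ring
      rw [Finset.sum_Ioc_succ_top (by omega), hbR]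
      change |R M| ≤ K at hRM
      set lM := Real.log M
      set lM' := Real.log ((M + 1 : ℕ) : ℝ)
      have h1 : |R M * (1 / lM - 1 / lM')| ≤ K * (1 / lM - 1 / lM') := by
        rw [abs_mul, abs_of_nonneg hw]
        gcongr
      have h2 : |(lM' - lM) / lM' - (Real.log lM' - Real.log lM)| ≤ 1 / lM - 1 / lM' := by
        have e : (lM' - lM) / lM - (lM' - lM) / lM' = (lM' - lM) * (1 / lM - 1 / lM') := by ring
        have e2 : (lM - lM') / lM' = - ((lM' - lM) / lM') := by ring
        have := mul_le_of_le_one_left hw hδ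
        rw [abs_le]
        constructor <;> linarith
      have h3 := abs_le.mp h1
      have h4 := abs_le.mp h2
      have h5 := abs_le.mp ih
      rw [abs_le]
      have e1 : (R (M + 1) - R M + (lM' - lM)) / lM' =
        R (M + 1) / lM' - R M / lM' + (lM' - lM) / lM' := by ring
      have e2 : R M * (1 / lM - 1 / lM') = R M / lM - R M / lM' := by ring
      rw [e1]
      rw [e2] at h3
      constructor <;> linarith [h3.1, h3.2, h4.1, h4.2, h5.1, h5.2]
  have hRN : |R N / Real.log N| ≤ K / Real.log N := by
    rw [abs_div, abs_of_pos (hlogpos hN)]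
    exact div_le_div_of_nonneg_right (hb N (by omega)) (hlogpos hN).le
  have hRM : |R M / Real.log M| ≤ K / Real.log M := by
    rw [abs_div, abs_of_pos (hlogpos (hN.trans hNM))]
    exact div_le_div_of_nonneg_right (hb M (by omega)) (hlogpos (hN.trans hNM)).le
  have hpos : 0 ≤ 1 / Real.log M := by positivity
  have e : (2 * K + 1) / Real.log N = (K + 1) * (1 / Real.log N - 1 / Real.log M) +
    K / Real.log M + K / Real.log N + 1 / Real.log M := by ring
  rw [e]
  have h3 := abs_le.mp hRN
  have h4 := abs_le.mp hRM
  have h5 := abs_le.mp key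
  rw [abs_le]
  constructor <;> linarith [h3.1, h3.2, h4.1, h4.2, h5.1, h5.2]

/-- The summatory function of `n ↦ Λ(n) / (n log n)` over integers coprime to `q`. -/
noncomputable def coprimeLogSum (q N : ℕ) : ℝ :=
  ∑ n ∈ Ioc 0 N, coprimeVonMangoldt q n / n / Real.log n

lemma coprimeLogSum_add_sum_Ioc (q : ℕ) {N M : ℕ} (h : N ≤ M) :
    coprimeLogSum q N + ∑ n ∈ Ioc N M, coprimeVonMangoldt q n / n / Real.log n =
      coprimeLogSum q M :=
  Finset.sum_Ioc_consecutive _ (Nat.zero_le N) h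

lemma exists_tendsto_coprimeLogSum {q : ℕ} (hq : q ≠ 0) :
    ∃ c K : ℝ, Tendsto (fun N : ℕ ↦ coprimeLogSum q N - Real.log (Real.log N)) atTop (𝓝 c) ∧
      ∀ N : ℕ, 2 ≤ N → coprimeLogSum q N ≤ Real.log (Real.log N) + c + K / Real.log N := by
  obtain ⟨K, hK⟩ := abs_sum_coprimeVonMangoldt_div_sub_log_le hq
  have key {N M : ℕ} (hN : 2 ≤ N) (hNM : N ≤ M) :
      |(coprimeLogSum q M - Real.log (Real.log M)) -
        (coprimeLogSum q N - Real.log (Real.log N))| ≤ (2 * K + 1) / Real.log N := by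
    have h := abs_sum_div_log_sub_log_log_le (b := fun n ↦ coprimeVonMangoldt q n / n) hK hN hNM
    convert h using 2
    rw [← coprimeLogSum_add_sum_Ioc q hNM]
    ring
  have hlim : Tendsto (fun N : ℕ ↦ (2 * K + 1) / Real.log N) atTop (𝓝 0) :=
    (Real.tendsto_log_atTop.comp tendsto_natCast_atTop_atTop).const_div_atTop _
  have hcauchy : CauchySeq fun N : ℕ ↦ coprimeLogSum q N - Real.log (Real.log N) := by
    rw [Metric.cauchySeq_iff']
    intro ε hε
    obtain ⟨N, hN, hN2⟩ := ((hlim.eventually (gt_mem_nhds hε)).and (eventually_ge_atTop 2)).exists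
    exact ⟨N, fun n hn ↦ (key hN2 hn).trans_lt hN⟩
  obtain ⟨c, hc⟩ := cauchySeq_tendsto_of_complete hcauchy
  refine ⟨c, 2 * K + 1, hc, fun N hN ↦ ?_⟩
  have : (coprimeLogSum q N - Real.log (Real.log N)) - (2 * K + 1) / Real.log N ≤ c := by
    refine ge_of_tendsto hc ?_
    filter_upwards [eventually_ge_atTop N] with M hM
    linarith [(abs_le.mp (key hN hM)).1]
  linarith

lemma tendsto_log_log_floor_exp_sub_log :
    Tendsto (fun k : ℕ ↦ Real.log (Real.log (⌊Real.exp k⌋₊ : ℕ)) - Real.log k) atTop (𝓝 0) := by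
  have hcast : Tendsto (fun k : ℕ ↦ (k : ℝ)) atTop atTop := tendsto_natCast_atTop_atTop
  have h1 : Tendsto (fun k : ℕ ↦ (⌊Real.exp k⌋₊ : ℝ) / Real.exp k) atTop (𝓝 1) :=
    tendsto_nat_floor_div_atTop.comp (Real.tendsto_exp_atTop.comp hcast)
  have h2 := (h1.log one_ne_zero).div_atTop hcast
  have h3 := (h2.add_const 1).log (by norm_num)
  rw [zero_add, Real.log_one] at h3
  refine h3.congr' ?_
  filter_upwards [eventually_ge_atTop 1] with k hk
  have hk0 : (0 : ℝ) < k := by exact_mod_cast hk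
  have hfl : 2 ≤ ⌊Real.exp k⌋₊ := by
    apply Nat.le_floor
    have := Real.add_one_le_exp (k : ℝ)
    have : (1 : ℝ) ≤ k := by exact_mod_cast hk
    push_cast; linarith
  have hl : 0 < Real.log (⌊Real.exp k⌋₊ : ℕ) := Real.log_pos (by exact_mod_cast hfl)
  rw [← Real.log_div hl.ne' hk0.ne', Real.log_div (by positivity) (Real.exp_pos _).ne',
    Real.log_exp, sub_div, div_self hk0.ne', sub_add_cancel]

/-- The sum of `Λ(n) / (n ^ s log n)` over `n` coprime to `q` is the logarithm of the `L`-function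
of the trivial character. -/
lemma summable_and_exp_tsum_coprimeVonMangoldt {q : ℕ} [NeZero q] {s : ℝ} (hs : 1 < s) :
    Summable (fun n : ℕ ↦ coprimeVonMangoldt q n / Real.log n / (n : ℝ) ^ s) ∧
    Real.exp (∑' n : ℕ, coprimeVonMangoldt q n / Real.log n / (n : ℝ) ^ s) =
      ‖LFunctionTrivChar q s‖ := by
  have hs' : 1 < (s : ℂ).re := by simpa
  constructor
  · refine (Real.summable_one_div_nat_rpow.mpr hs).of_nonneg_of_le (fun n ↦ ?_) fun n ↦ ?_
    · have := coprimeVonMangoldt_nonneg q n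
      have := Real.log_natCast_nonneg n
      positivity
    · gcongr
      exact div_le_one_of_le₀ (coprimeVonMangoldt_le_log q n) (Real.log_natCast_nonneg n)
  · have h := LSeries_eq_exp_LSeries (1 : DirichletCharacter ℂ q) hs'
    have h2 := LFunction_eq_LSeries (1 : DirichletCharacter ℂ q) hs'
    rw [LFunctionTrivChar, h2, ← h, Complex.norm_exp, LSeries_def₀ (by simp)]
    congr 1
    rw [← Complex.ofReal_re (∑' n : ℕ, coprimeVonMangoldt q n / Real.log n / (n : ℝ) ^ s),
      Complex.ofReal_tsum]
    congr 2 with n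
    have hchar : (1 : DirichletCharacter ℂ q) n * (ArithmeticFunction.vonMangoldt n : ℂ) =
        (coprimeVonMangoldt q n : ℂ) := by
      unfold coprimeVonMangoldt
      split_ifs with hc
      · rw [MulChar.one_apply ((ZMod.isUnit_iff_coprime n q).mpr hc), one_mul]
      · rw [MulChar.map_nonunit _ (mt (ZMod.isUnit_iff_coprime n q).mp hc), zero_mul,
          Complex.ofReal_zero]
    rw [hchar, Complex.ofReal_div, Complex.ofReal_div, Complex.ofReal_cpow n.cast_nonneg]
    simp

/-- Grouping the integers according to the integer part of their logarithm. -/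
lemma sum_range_coprimeLogSum_mul_le (q : ℕ) {ε : ℝ} (hε : 0 < ε) (K : ℕ) :
    ∑ k ∈ range (K + 1), (coprimeLogSum q ⌊Real.exp k⌋₊ -
        coprimeLogSum q ⌊Real.exp ((k - 1 : ℕ) : ℝ)⌋₊) * Real.exp (-ε) ^ k ≤
      ∑ n ∈ Ioc 0 ⌊Real.exp K⌋₊,
        coprimeVonMangoldt q n / Real.log n / (n : ℝ) ^ (1 + ε) := by
  induction K with
  | zero => simp
  | succ K ih =>
    rw [Finset.sum_range_succ]
    have hle : ⌊Real.exp K⌋₊ ≤ ⌊Real.exp ((K + 1 : ℕ) : ℝ)⌋₊ :=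
      Nat.floor_le_floor (Real.exp_le_exp.mpr (by push_cast; linarith))
    rw [← Finset.sum_Ioc_consecutive _ (Nat.zero_le _) hle, Nat.add_sub_cancel,
      ← coprimeLogSum_add_sum_Ioc q hle, add_sub_cancel_left, Finset.sum_mul]
    refine add_le_add ih (Finset.sum_le_sum fun n hn ↦ ?_)
    obtain ⟨hn1, hn2⟩ := Finset.mem_Ioc.mp hn
    have hn0 : (0 : ℝ) < n := by exact_mod_cast Nat.zero_lt_of_lt hn1
    have hn3 : (n : ℝ) ≤ Real.exp ((K + 1 : ℕ) : ℝ) :=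
      (Nat.le_floor_iff (Real.exp_pos _).le).mp hn2
    have hpow : Real.exp (-ε) ^ (K + 1) ≤ ((n : ℝ) ^ ε)⁻¹ := by
      rw [← Real.exp_nat_mul, mul_neg, Real.exp_neg, Real.exp_mul]
      gcongr
    have h0 : 0 ≤ coprimeVonMangoldt q n / n / Real.log n := by
      have := coprimeVonMangoldt_nonneg q n
      have := Real.log_natCast_nonneg n
      positivity
    calc _ ≤ coprimeVonMangoldt q n / n / Real.log n * ((n : ℝ) ^ ε)⁻¹ := by gcongr
      _ = _ := by rw [Real.rpow_add hn0, Real.rpow_one]; ring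

lemma coprimeLogSum_mono (q : ℕ) : Monotone (coprimeLogSum q) := by
  intro N M h
  rw [← coprimeLogSum_add_sum_Ioc q h, le_add_iff_nonneg_right]
  refine Finset.sum_nonneg fun n _ ↦ ?_
  have := coprimeVonMangoldt_nonneg q n
  have := Real.log_natCast_nonneg n
  positivity

lemma tsum_coprimeLogSum_sub_inv_le {q : ℕ} [NeZero q] {ε : ℝ} (hε : 0 < ε) :
    Real.exp (∑' k : ℕ, (coprimeLogSum q ⌊Real.exp k⌋₊ -
        coprimeLogSum q ⌊Real.exp ((k - 1 : ℕ) : ℝ)⌋₊ - (k : ℝ)⁻¹) * Real.exp (-ε) ^ k) ≤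
      ‖LFunctionTrivChar q ((1 + ε : ℝ) : ℂ)‖ * (1 - Real.exp (-ε)) := by
  obtain ⟨hsum, hexp⟩ :=
    summable_and_exp_tsum_coprimeVonMangoldt (q := q) (s := 1 + ε) (by linarith)
  have hx0 : 0 < Real.exp (-ε) := Real.exp_pos _
  have hx1 : Real.exp (-ε) < 1 := Real.exp_lt_one_iff.mpr (by linarith)
  have hnn (n : ℕ) : 0 ≤ coprimeVonMangoldt q n / Real.log n / (n : ℝ) ^ (1 + ε) := by
    have := coprimeVonMangoldt_nonneg q n
    have := Real.log_natCast_nonneg n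
    positivity
  set B : ℕ → ℝ := fun k ↦ (coprimeLogSum q ⌊Real.exp k⌋₊ -
        coprimeLogSum q ⌊Real.exp ((k - 1 : ℕ) : ℝ)⌋₊) * Real.exp (-ε) ^ k with hB
  have hB0 (k : ℕ) : 0 ≤ B k := by
    refine mul_nonneg (sub_nonneg.mpr (coprimeLogSum_mono q ?_)) (by positivity)
    exact Nat.floor_le_floor (Real.exp_le_exp.mpr (by exact_mod_cast Nat.sub_le k 1))
  have hBle (K : ℕ) : ∑ k ∈ range K, B k ≤
      ∑' n : ℕ, coprimeVonMangoldt q n / Real.log n / (n : ℝ) ^ (1 + ε) := by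
    calc _ ≤ ∑ k ∈ range (K + 1), B k := by
          rw [Finset.sum_range_succ]; linarith [hB0 K]
      _ ≤ _ := sum_range_coprimeLogSum_mul_le q hε K
      _ ≤ _ := hsum.sum_le_tsum _ fun n _ ↦ hnn n
  have hBs : Summable B := summable_of_sum_range_le hB0 hBle
  have hBt := Real.tsum_le_of_sum_range_le hB0 hBle
  have hH : HasSum (fun k : ℕ ↦ (k : ℝ)⁻¹ * Real.exp (-ε) ^ k)
      (-Real.log (1 - Real.exp (-ε))) := by
    rw [← hasSum_nat_add_iff' 1]
    have := Real.hasSum_pow_div_log_of_abs_lt_one (x := Real.exp (-ε))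
      (by rwa [abs_of_pos hx0])
    simpa [div_eq_inv_mul] using this
  have hsub := (hBs.hasSum.sub hH).tsum_eq
  simp only [hB, ← sub_mul] at hsub
  rw [hsub, ← hexp, sub_neg_eq_add, Real.exp_add, Real.exp_log (by linarith)]
  gcongr

lemma tendsto_norm_LFunctionTrivChar_mul {q : ℕ} [NeZero q] :
    Tendsto (fun ε : ℝ ↦ ‖LFunctionTrivChar q ((1 + ε : ℝ) : ℂ)‖ * (1 - Real.exp (-ε)))
      (𝓝[>] 0) (𝓝 ((q.totient : ℝ) / q)) := by
  have hprod : ((q.totient : ℝ) / q) = ‖∏ p ∈ q.primeFactors, (1 - (p : ℂ)⁻¹)‖ := by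
    have h := congrArg (Rat.cast : ℚ → ℂ) (Nat.totient_eq_mul_prod_factors q)
    push_cast at h
    have hq : (q : ℂ) ≠ 0 := NeZero.ne _
    rw [eq_div_of_mul_eq hq ((mul_comm _ _).trans h.symm)]
    simp
  have h1 : Tendsto (fun ε : ℝ ↦ ((1 + ε : ℝ) : ℂ)) (𝓝[>] 0) (𝓝[≠] 1) := by
    rw [tendsto_nhdsWithin_iff]
    constructor
    · have : Continuous fun ε : ℝ ↦ ((1 + ε : ℝ) : ℂ) := by fun_prop
      simpa using (this.tendsto 0).mono_left nhdsWithin_le_nhds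
    · filter_upwards [self_mem_nhdsWithin] with ε hε
      have : ε ≠ 0 := ne_of_gt hε
      simpa using this
  have h2 := ((LFunctionTrivChar_residue_one (N := q)).comp h1).norm
  rw [← hprod] at h2
  have h3 : Tendsto (fun ε : ℝ ↦ (1 - Real.exp (-ε)) / ε) (𝓝[>] 0) (𝓝 1) := by
    have hd : HasDerivAt (fun ε : ℝ ↦ 1 - Real.exp (-ε)) 1 0 := by
      simpa using ((hasDerivAt_neg (0 : ℝ)).exp).const_sub 1
    have := (hd.tendsto_slope).mono_left
      (nhdsWithin_mono 0 fun x (hx : 0 < x) ↦ ne_of_gt hx : 𝓝[>] (0 : ℝ) ≤ 𝓝[≠] 0)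
    refine this.congr fun ε ↦ ?_
    simp [slope_def_field]
  have h4 := h2.mul h3
  rw [mul_one] at h4
  refine h4.congr' ?_
  filter_upwards [self_mem_nhdsWithin] with ε hε
  have hε : 0 < ε := hε
  have e : ((1 + ε : ℝ) : ℂ) - 1 = (ε : ℂ) := by push_cast; ring
  simp only [Function.comp_apply]
  rw [e, norm_mul, Complex.norm_real, Real.norm_of_nonneg hε.le]
  field_simp

/-- The constant in Mertens' theorem for integers coprime to `q`, bounded by combining Abel's limit
theorem with the residue of the `L`-function of the trivial character. -/
lemma le_of_tendsto_coprimeLogSum {q : ℕ} [NeZero q] {c : ℝ}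
    (hc : Tendsto (fun N : ℕ ↦ coprimeLogSum q N - Real.log (Real.log N)) atTop (𝓝 c)) :
    c ≤ Real.eulerMascheroniConstant - Real.log ((q : ℝ) / q.totient) := by
  set f : ℕ → ℝ := fun k ↦ coprimeLogSum q ⌊Real.exp k⌋₊ -
        coprimeLogSum q ⌊Real.exp ((k - 1 : ℕ) : ℝ)⌋₊ - (k : ℝ)⁻¹ with hf
  have hsum (n : ℕ) : ∑ k ∈ range (n + 1), f k =
      coprimeLogSum q ⌊Real.exp n⌋₊ - harmonic n := by
    induction n with
    | zero => simp [hf, coprimeLogSum]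
    | succ n ih =>
      rw [Finset.sum_range_succ, ih, harmonic_succ]
      simp only [hf, Nat.add_sub_cancel]
      push_cast
      ring
  have hfloor : Tendsto (fun k : ℕ ↦ ⌊Real.exp k⌋₊) atTop atTop :=
    tendsto_nat_floor_atTop.comp (Real.tendsto_exp_atTop.comp tendsto_natCast_atTop_atTop)
  have hlim : Tendsto (fun n ↦ ∑ k ∈ range n, f k) atTop
      (𝓝 (c - Real.eulerMascheroniConstant)) := by
    rw [← tendsto_add_atTop_iff_nat 1]
    simp only [hsum]
    have := ((hc.comp hfloor).add tendsto_log_log_floor_exp_sub_log).sub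
      Real.tendsto_harmonic_sub_log
    rw [add_zero] at this
    refine this.congr fun n ↦ ?_
    simp only [Function.comp_apply]
    ring
  have hx : Tendsto (fun ε : ℝ ↦ Real.exp (-ε)) (𝓝[>] 0) (𝓝[<] 1) := by
    rw [tendsto_nhdsWithin_iff]
    constructor
    · have : Continuous fun ε : ℝ ↦ Real.exp (-ε) := by fun_prop
      simpa using (this.tendsto 0).mono_left nhdsWithin_le_nhds
    · filter_upwards [self_mem_nhdsWithin] with ε hε
      exact Real.exp_lt_one_iff.mpr (neg_lt_zero.mpr hε)
  have habel := (Real.tendsto_tsum_powerSeries_nhdsWithin_lt hlim).comp hx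
  have hle : Real.exp (c - Real.eulerMascheroniConstant) ≤ (q.totient : ℝ) / q := by
    refine le_of_tendsto_of_tendsto ((Real.continuous_exp.tendsto _).comp habel)
      tendsto_norm_LFunctionTrivChar_mul ?_
    filter_upwards [self_mem_nhdsWithin] with ε hε
    exact tsum_coprimeLogSum_sub_inv_le hε
  have hq : (0 : ℝ) < q := by exact_mod_cast NeZero.pos q
  have hφ : (0 : ℝ) < q.totient := by exact_mod_cast Nat.totient_pos.mpr (NeZero.pos q)
  rw [← Real.le_log_iff_exp_le (by positivity), ← inv_div, Real.log_inv] at hle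
  linarith

lemma re_sum_le_coprimeLogSum {q : ℕ} (χ : DirichletCharacter ℂ q) (N : ℕ) {s : ℂ}
    (hs : 1 ≤ s.re) :
    (∑ n ∈ Finset.Ioc 1 N, (ArithmeticFunction.vonMangoldt n : ℂ) * χ (n : ZMod q) /
      ((n : ℂ) ^ s * (Real.log n : ℂ))).re ≤ coprimeLogSum q N := by
  have hnn (n : ℕ) : 0 ≤ coprimeVonMangoldt q n / n / Real.log n := by
    have := coprimeVonMangoldt_nonneg q n
    have := Real.log_natCast_nonneg n
    positivity
  refine (Complex.re_le_norm _).trans <| (norm_sum_le _ _).trans ?_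
  refine (Finset.sum_le_sum fun n hn ↦ ?_).trans <| Finset.sum_le_sum_of_subset_of_nonneg
    (Finset.Ioc_subset_Ioc_left zero_le_one) fun n _ _ ↦ hnn n
  have hn1 : 1 < n := (Finset.mem_Ioc.mp hn).1
  have hn1' : (1 : ℝ) ≤ n := by exact_mod_cast hn1.le
  have hn0 : (0 : ℝ) < n := by linarith
  have hl : 0 < Real.log n := Real.log_pos (by exact_mod_cast hn1)
  have hnum : ‖(ArithmeticFunction.vonMangoldt n : ℂ) * χ (n : ZMod q)‖ ≤
      coprimeVonMangoldt q n := by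
    unfold coprimeVonMangoldt
    split_ifs with hc
    · rw [norm_mul, Complex.norm_real,
        Real.norm_of_nonneg ArithmeticFunction.vonMangoldt_nonneg]
      exact mul_le_of_le_one_right ArithmeticFunction.vonMangoldt_nonneg (χ.norm_le_one _)
    · rw [MulChar.map_nonunit _ (mt (ZMod.isUnit_iff_coprime n q).mp hc)]
      simp
  have hpow : (n : ℝ) ≤ ‖(n : ℂ) ^ s‖ := by
    rw [Complex.norm_natCast_cpow_of_pos (by omega)]
    exact Real.self_le_rpow_of_one_le hn1' hs
  rw [norm_div, norm_mul _ (Real.log n : ℂ), Complex.norm_real, Real.norm_of_nonneg hl.le,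
    div_div]
  have := coprimeVonMangoldt_nonneg q n
  gcongr

/-- For a primitive character `χ` mod `q`, `x ≥ 3` and `Re s ≥ 1`,
`Re ∑_{1 < n ≤ x} Λ(n) χ(n)/(n^s log n) ≤ log log x + C₀ − log(q/φ(q)) + O(1/log x)`. -/
theorem re_log_sum_upper (q : ℕ) (hq : 2 < q)
    (χ : DirichletCharacter ℂ q) (hχ : χ.IsPrimitive) :
    ∃ C : ℝ, 0 < C ∧
      ∀ x : ℝ, 3 ≤ x → ∀ s : ℂ, 1 ≤ s.re →
        (∑ n ∈ Finset.Ioc 1 ⌊x⌋₊,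
            (ArithmeticFunction.vonMangoldt n : ℂ) * χ (n : ZMod q) /
              ((n : ℂ) ^ s * (Real.log n : ℂ))).re ≤
          Real.log (Real.log x) + Real.eulerMascheroniConstant -
            Real.log ((q : ℝ) / (Nat.totient q : ℝ)) + C / Real.log x := by
  have : NeZero q := ⟨by omega⟩
  obtain ⟨c, K, hc, hle⟩ := exists_tendsto_coprimeLogSum (NeZero.ne q)
  refine ⟨2 * |K| + 1, by positivity, fun x hx s hs ↦ ?_⟩
  have hN : 3 ≤ ⌊x⌋₊ := Nat.le_floor (by exact_mod_cast hx)
  have hN' : (3 : ℝ) ≤ (⌊x⌋₊ : ℝ) := by exact_mod_cast hN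
  have hfx : (⌊x⌋₊ : ℝ) ≤ x := Nat.floor_le (by linarith)
  have hlN : 0 < Real.log (⌊x⌋₊ : ℝ) := Real.log_pos (by linarith)
  have hlx : 0 < Real.log x := Real.log_pos (by linarith)
  have hlog : Real.log (⌊x⌋₊ : ℝ) ≤ Real.log x := Real.log_le_log (by linarith) hfx
  have hloglog : Real.log (Real.log (⌊x⌋₊ : ℝ)) ≤ Real.log (Real.log x) :=
    Real.log_le_log hlN hlog
  have hlx2 : Real.log x ≤ 2 * Real.log (⌊x⌋₊ : ℝ) := by
    rw [← Nat.cast_ofNat, ← Real.log_pow]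
    apply Real.log_le_log (by linarith)
    nlinarith [Nat.lt_floor_add_one x]
  have herr : K / Real.log (⌊x⌋₊ : ℝ) ≤ (2 * |K| + 1) / Real.log x := by
    rw [div_le_div_iff₀ hlN hlx]
    calc K * Real.log x ≤ |K| * (2 * Real.log (⌊x⌋₊ : ℝ)) := by
          gcongr; exact le_abs_self K
      _ ≤ (2 * |K| + 1) * Real.log (⌊x⌋₊ : ℝ) := by linarith
  linarith [re_sum_le_coprimeLogSum χ ⌊x⌋₊ hs, hle ⌊x⌋₊ (by omega),
    le_of_tendsto_coprimeLogSum hc]
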